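/- arXiv:1509.02646 — 4 statements merged into one kernel-verified Lean document; each statement's English description precedes it below -/
import Mathlib

section
/- For every real x with 0 < x < π/2, one has | 𝒥(x) − ln(4/(e·x)) | ≤ π²x²/8, where 𝒥(x) = (π²/4) ∫_{Φ(2x/π)}^{1} dt/(t·E(t)²). -/
open MeasureTheory

/-- Complete Legendre elliptic integral of the second kind. -/
noncomputable def ellE (k : ℝ) : ℝ :=
  ∫ t in (0:ℝ)..1, Real.sqrt ((1 - k^2 * t^2) / (1 - t^2))

/-- Complete Legendre elliptic integral of the first kind. -/
noncomputable def ellK (k : ℝ) : ℝ :=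
  ∫ t in (0:ℝ)..1, 1 / Real.sqrt ((1 - t^2) * (1 - k^2 * t^2))

/-- The function `Ψ(k) = k / E(k)`. -/
noncomputable def PsiFn (k : ℝ) : ℝ := k / ellE k

/-- `Φ`, the inverse on `[0,1]` of the strictly increasing bijection `Ψ`. -/
noncomputable def PhiFn (x : ℝ) : ℝ :=
  sSup {y : ℝ | y ∈ Set.Icc (0:ℝ) 1 ∧ PsiFn y ≤ x}

/-- The function `𝒥(x) = (π²/4) ∫_{Φ(2x/π)}^1 dt/(t E(t)²)`. -/
noncomputable def Jcal (x : ℝ) : ℝ :=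
  (Real.pi^2 / 4) * ∫ t in PhiFn (2*x/Real.pi)..(1:ℝ), 1 / (t * (ellE t)^2)

/-- The function `𝒥_l(c) = (π/2) ∫_c^{πl/2} dτ/(Φ(2τ/(πl)) K(Φ(2τ/(πl))))`. -/
noncomputable def Jl (l c : ℝ) : ℝ :=
  (Real.pi / 2) * ∫ τ in c..(Real.pi * l / 2),
    1 / (PhiFn (2*τ/(Real.pi*l)) * ellK (PhiFn (2*τ/(Real.pi*l))))

/-- The approximation `λ̃_n(c)`. -/
noncomputable def lambdaTilde (n : ℕ) (c : ℝ) : ℝ :=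
  (1/2) * Real.exp (-(Real.pi^2 * ((n:ℝ) + 1/2) / 2) *
    ∫ t in PhiFn (2*c/(Real.pi*((n:ℝ)+1/2)))..(1:ℝ), 1 / (t * (ellE t)^2))

/-- The kernel `sin(c(x-y))/(π(x-y))`, with value `c/π` on the diagonal. -/
noncomputable def sincKernel (c x y : ℝ) : ℝ :=
  if x = y then c / Real.pi else Real.sin (c*(x-y)) / (Real.pi * (x-y))

/-- The quadratic form `⟨Q_c f, f⟩` of the time-and-frequency limiting operator `Q_c`. -/
noncomputable def QForm (c : ℝ) (f : ℝ → ℝ) : ℝ :=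
  ∫ x in Set.Ioo (-1:ℝ) 1, ∫ y in Set.Ioo (-1:ℝ) 1, sincKernel c x y * f y * f x

/-- The `(n+1)`-st eigenvalue `λ_n(c)` of `Q_c`, via the Courant–Fischer min-max principle. -/
noncomputable def lambda (n : ℕ) (c : ℝ) : ℝ :=
  ⨆ V : {V : Submodule ℝ (Lp ℝ 2 (volume.restrict (Set.Ioo (-1:ℝ) 1))) //
          Module.finrank ℝ V = n + 1},
    ⨅ f : {f : Lp ℝ 2 (volume.restrict (Set.Ioo (-1:ℝ) 1)) // f ∈ V.1 ∧ f ≠ 0},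
      QForm c (f.1 : ℝ → ℝ) / ‖f.1‖^2

section

open Real Set Filter Topology

/-- Differentiation under the integral sign for an integrand that is continuously differentiable
in the parameter. -/
theorem hasDerivAt_intervalIntegral_of_continuousOn {U : Set ℝ} (hU : IsOpen U) {F F' : ℝ → ℝ → ℝ}
    (hF : ContinuousOn (Function.uncurry F) (U ×ˢ univ))
    (hF' : ContinuousOn (Function.uncurry F') (U ×ˢ univ))
    (hd : ∀ x ∈ U, ∀ t, HasDerivAt (fun y => F y t) (F' x t) x) (a b : ℝ) {x₀ : ℝ} (hx₀ : x₀ ∈ U) :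
    HasDerivAt (fun x => ∫ t in a..b, F x t) (∫ t in a..b, F' x₀ t) x₀ := by
  obtain ⟨ε, hε, hball⟩ := Metric.isOpen_iff.1 hU x₀ hx₀
  have hsub : Metric.closedBall x₀ (ε / 2) ⊆ U :=
    (Metric.closedBall_subset_ball (by linarith)).trans hball
  obtain ⟨C, hC⟩ := ((isCompact_closedBall x₀ (ε / 2)).prod
    (isCompact_uIcc (a := a) (b := b))).exists_bound_of_continuousOn
      (hF'.mono (prod_mono hsub (subset_univ _)))
  have hcont : ∀ {G : ℝ → ℝ → ℝ}, ContinuousOn (Function.uncurry G) (U ×ˢ univ) →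
      ∀ x ∈ U, Continuous (G x) := fun {G} hG x hx => by
    have : ContinuousOn (fun t => Function.uncurry G (x, t)) univ :=
      hG.comp (by fun_prop) (fun t _ => ⟨hx, mem_univ _⟩)
    simpa [continuousOn_univ] using this
  refine (intervalIntegral.hasDerivAt_integral_of_dominated_loc_of_deriv_le
    (s := Metric.closedBall x₀ (ε / 2)) (bound := fun _ => C)
    (Metric.closedBall_mem_nhds x₀ (by linarith)) ?_ ?_ ?_ ?_ ?_ ?_).2
  · filter_upwards [hU.mem_nhds hx₀] with x hx
    exact (hcont hF x hx).aestronglyMeasurable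
  · exact (hcont hF x₀ hx₀).intervalIntegrable _ _
  · exact (hcont hF' x₀ hx₀).aestronglyMeasurable
  · refine Eventually.of_forall fun t ht x hx => ?_
    exact hC (x, t) ⟨hx, uIoc_subset_uIcc ht⟩
  · exact intervalIntegrable_const
  · exact Eventually.of_forall fun t _ x hx => hd x (hsub hx) t

/-- The complete elliptic integral of the second kind in trigonometric form, as a function of the
parameter `m = k²`. -/
noncomputable def paramE (m : ℝ) : ℝ := ∫ θ in (0:ℝ)..(π / 2), √(1 - m * sin θ ^ 2)

/-- The complete elliptic integral of the first kind in trigonometric form, as a function of the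
parameter `m = k²`. -/
noncomputable def paramK (m : ℝ) : ℝ := ∫ θ in (0:ℝ)..(π / 2), 1 / √(1 - m * sin θ ^ 2)

theorem one_sub_mul_sin_sq_pos {m : ℝ} (hm : m < 1) (θ : ℝ) : 0 < 1 - m * sin θ ^ 2 := by
  rcases le_or_gt m 0 with h | h
  · nlinarith [sq_nonneg (sin θ)]
  · nlinarith [sin_sq_le_one θ]

theorem continuous_sqrt_one_sub_mul_sin_sq (m : ℝ) :
    Continuous fun θ : ℝ => √(1 - m * sin θ ^ 2) := by fun_prop

theorem continuous_one_div_sqrt_one_sub_mul_sin_sq {m : ℝ} (hm : m < 1) :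
    Continuous fun θ : ℝ => 1 / √(1 - m * sin θ ^ 2) :=
  continuous_const.div (by fun_prop) fun θ => (sqrt_pos.2 (one_sub_mul_sin_sq_pos hm θ)).ne'

theorem continuous_paramE : Continuous paramE := by
  unfold paramE
  exact intervalIntegral.continuous_parametric_intervalIntegral_of_continuous' (by fun_prop) _ _

theorem hasDerivAt_paramE_aux {m : ℝ} (hm : m < 1) :
    HasDerivAt paramE (∫ θ in (0:ℝ)..(π / 2), -(sin θ ^ 2) / (2 * √(1 - m * sin θ ^ 2))) m := by
  refine hasDerivAt_intervalIntegral_of_continuousOn (isOpen_Iio (a := (1 : ℝ)))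
    (F := fun m θ => √(1 - m * sin θ ^ 2))
    (F' := fun m θ => -(sin θ ^ 2) / (2 * √(1 - m * sin θ ^ 2))) ?_ ?_ ?_ _ _ hm
  · exact Continuous.continuousOn (by unfold Function.uncurry; fun_prop)
  · refine ContinuousOn.div (by fun_prop) (by fun_prop) fun p hp => ?_
    have := sqrt_pos.2 (one_sub_mul_sin_sq_pos (mem_Iio.1 hp.1) p.2)
    positivity
  · intro x hx θ
    have h := (((hasDerivAt_id x).mul_const (sin θ ^ 2)).const_sub 1).sqrt
      (one_sub_mul_sin_sq_pos hx θ).ne'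
    simpa using h

theorem hasDerivAt_paramK_aux {m : ℝ} (hm : m < 1) :
    HasDerivAt paramK (∫ θ in (0:ℝ)..(π / 2), sin θ ^ 2 / (2 * √(1 - m * sin θ ^ 2) ^ 3)) m := by
  refine hasDerivAt_intervalIntegral_of_continuousOn (isOpen_Iio (a := (1 : ℝ)))
    (F := fun m θ => 1 / √(1 - m * sin θ ^ 2))
    (F' := fun m θ => sin θ ^ 2 / (2 * √(1 - m * sin θ ^ 2) ^ 3)) ?_ ?_ ?_ _ _ hm
  · refine ContinuousOn.div (by fun_prop) (by fun_prop) fun p hp => ?_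
    exact (sqrt_pos.2 (one_sub_mul_sin_sq_pos (mem_Iio.1 hp.1) p.2)).ne'
  · refine ContinuousOn.div (by fun_prop) (by fun_prop) fun p hp => ?_
    have := sqrt_pos.2 (one_sub_mul_sin_sq_pos (mem_Iio.1 hp.1) p.2)
    positivity
  · intro x hx θ
    have h0 := sqrt_pos.2 (one_sub_mul_sin_sq_pos hx θ)
    have h := ((((hasDerivAt_id x).mul_const (sin θ ^ 2)).const_sub 1).sqrt
      (one_sub_mul_sin_sq_pos hx θ).ne').fun_inv h0.ne'
    simp only [one_div]
    refine h.congr_deriv ?_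
    simp only [id]
    field_simp

theorem integral_one_div_sqrt_pow_three {m : ℝ} (hm : m < 1) :
    ∫ θ in (0:ℝ)..(π / 2), 1 / √(1 - m * sin θ ^ 2) ^ 3 = paramE m / (1 - m) := by
  have hpos := fun θ => sqrt_pos.2 (one_sub_mul_sin_sq_pos hm θ)
  have hc3 : Continuous fun θ : ℝ => 1 / √(1 - m * sin θ ^ 2) ^ 3 :=
    continuous_const.div (by fun_prop) fun θ => (pow_pos (hpos θ) 3).ne'
  have hd : ∀ θ : ℝ, HasDerivAt (fun θ => m * (sin θ * cos θ) / √(1 - m * sin θ ^ 2))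
      (√(1 - m * sin θ ^ 2) - (1 - m) * (1 / √(1 - m * sin θ ^ 2) ^ 3)) θ := by
    intro θ
    have h1 := ((hasDerivAt_sin θ).fun_mul (hasDerivAt_cos θ)).const_mul m
    have h2 := ((((hasDerivAt_sin θ).fun_pow 2).const_mul m).const_sub 1).sqrt
      (one_sub_mul_sin_sq_pos hm θ).ne'
    refine (h1.fun_div h2 (hpos θ).ne').congr_deriv ?_
    have hs := sq_sqrt (one_sub_mul_sin_sq_pos hm θ).le
    have h0 := (hpos θ).ne'
    have hcs := cos_sq' θ
    set D := √(1 - m * sin θ ^ 2)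
    set s := sin θ
    set c := cos θ
    field_simp
    have e1 : D ^ 4 = (1 - m * s ^ 2) ^ 2 := by rw [← hs]; ring
    simp only [Nat.cast_ofNat, Nat.add_one_sub_one, pow_one]
    rw [e1, hs, hcs]
    ring
  have h := intervalIntegral.integral_eq_sub_of_hasDerivAt (a := 0) (b := π / 2)
    (fun θ _ => hd θ)
    (((continuous_sqrt_one_sub_mul_sin_sq m).sub (hc3.const_mul _)).intervalIntegrable _ _)
  rw [intervalIntegral.integral_sub
    ((continuous_sqrt_one_sub_mul_sin_sq m).intervalIntegrable _ _)
    ((hc3.const_mul _).intervalIntegrable _ _), intervalIntegral.integral_const_mul] at h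
  simp only [cos_pi_div_two, sin_zero, mul_zero, zero_mul, zero_div, sub_self] at h
  rw [eq_div_iff (by linarith)]
  unfold paramE
  linarith

theorem hasDerivAt_paramE {m : ℝ} (hm0 : m ≠ 0) (hm : m < 1) :
    HasDerivAt paramE ((paramE m - paramK m) / (2 * m)) m := by
  refine (hasDerivAt_paramE_aux hm).congr_deriv ?_
  rw [paramE, paramK, ← intervalIntegral.integral_sub
    ((continuous_sqrt_one_sub_mul_sin_sq m).intervalIntegrable _ _)
    ((continuous_one_div_sqrt_one_sub_mul_sin_sq hm).intervalIntegrable _ _),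
    ← intervalIntegral.integral_div]
  refine intervalIntegral.integral_congr fun θ _ => ?_
  have h0 := sqrt_pos.2 (one_sub_mul_sin_sq_pos hm θ)
  have hs := sq_sqrt (one_sub_mul_sin_sq_pos hm θ).le
  set D := √(1 - m * sin θ ^ 2)
  field_simp
  rw [hs]
  ring

theorem hasDerivAt_paramK {m : ℝ} (hm0 : m ≠ 0) (hm : m < 1) :
    HasDerivAt paramK ((paramE m / (1 - m) - paramK m) / (2 * m)) m := by
  refine (hasDerivAt_paramK_aux hm).congr_deriv ?_
  have hpos := fun θ => sqrt_pos.2 (one_sub_mul_sin_sq_pos hm θ)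
  have hc3 : Continuous fun θ : ℝ => 1 / √(1 - m * sin θ ^ 2) ^ 3 :=
    continuous_const.div (by fun_prop) fun θ => (pow_pos (hpos θ) 3).ne'
  rw [← integral_one_div_sqrt_pow_three hm, paramK, ← intervalIntegral.integral_sub
    (hc3.intervalIntegrable _ _)
    ((continuous_one_div_sqrt_one_sub_mul_sin_sq hm).intervalIntegrable _ _),
    ← intervalIntegral.integral_div]
  refine intervalIntegral.integral_congr fun θ _ => ?_
  have h0 := hpos θ
  have hs := sq_sqrt (one_sub_mul_sin_sq_pos hm θ).le
  set D := √(1 - m * sin θ ^ 2)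
  field_simp
  rw [hs]
  ring

theorem paramE_zero : paramE 0 = π / 2 := by simp [paramE]

theorem paramK_zero : paramK 0 = π / 2 := by simp [paramK]

theorem integral_cos_zero_pi_div_two : ∫ θ in (0:ℝ)..(π / 2), cos θ = 1 := by simp

theorem antitone_paramE : Antitone paramE := fun m n hmn => by
  refine intervalIntegral.integral_mono_on (by positivity)
    ((continuous_sqrt_one_sub_mul_sin_sq n).intervalIntegrable _ _)
    ((continuous_sqrt_one_sub_mul_sin_sq m).intervalIntegrable _ _) fun θ _ => ?_
  gcongr

theorem paramE_one : paramE 1 = 1 := by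
  refine Eq.trans ?_ integral_cos_zero_pi_div_two
  refine intervalIntegral.integral_congr fun θ hθ => ?_
  rw [uIcc_of_le (by positivity)] at hθ
  rw [one_mul, ← cos_sq', sqrt_sq (cos_nonneg_of_mem_Icc ⟨by linarith [hθ.1, pi_pos], hθ.2⟩)]

theorem one_le_paramE {m : ℝ} (hm : m ≤ 1) : 1 ≤ paramE m :=
  paramE_one ▸ antitone_paramE hm

theorem paramE_le {m : ℝ} (hm : 0 ≤ m) : paramE m ≤ π / 2 :=
  paramE_zero ▸ antitone_paramE hm

theorem one_sub_mul_paramK_le {m : ℝ} (hm0 : 0 ≤ m) (hm : m < 1) :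
    (1 - m) * paramK m ≤ paramE m := by
  rw [paramK, paramE, ← intervalIntegral.integral_const_mul]
  refine intervalIntegral.integral_mono_on (by positivity)
    (((continuous_one_div_sqrt_one_sub_mul_sin_sq hm).const_mul _).intervalIntegrable _ _)
    ((continuous_sqrt_one_sub_mul_sin_sq m).intervalIntegrable _ _) fun θ _ => ?_
  have h0 := sqrt_pos.2 (one_sub_mul_sin_sq_pos hm θ)
  rw [mul_one_div, div_le_iff₀ h0, mul_self_sqrt (one_sub_mul_sin_sq_pos hm θ).le]
  nlinarith [sin_sq_le_one θ]

theorem paramK_le {m : ℝ} (hm0 : 0 ≤ m) (hm : m < 1) : paramK m ≤ (π / 2) / √(1 - m) := by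
  have h : ∫ _θ in (0:ℝ)..(π / 2), 1 / √(1 - m) = (π / 2) / √(1 - m) := by
    simp [div_eq_mul_inv]
  rw [← h]
  refine intervalIntegral.integral_mono_on (by positivity)
    ((continuous_one_div_sqrt_one_sub_mul_sin_sq hm).intervalIntegrable _ _)
    intervalIntegrable_const fun θ _ => ?_
  have : 0 < √(1 - m) := sqrt_pos.2 (by linarith)
  gcongr
  nlinarith [sin_sq_le_one θ]

/-- The Cauchy–Schwarz inequality for the two complete elliptic integrals. -/
theorem sq_le_paramK_mul_paramE {m : ℝ} (hm : m < 1) : (π / 2) ^ 2 ≤ paramK m * paramE m := by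
  have hE : 0 < paramE m := one_pos.trans_le (one_le_paramE hm.le)
  set t := π / 2 / paramE m with ht
  have h : ∫ _θ in (0:ℝ)..(π / 2), 2 * t ≤
      ∫ θ in (0:ℝ)..(π / 2), (t ^ 2 * √(1 - m * sin θ ^ 2) + 1 / √(1 - m * sin θ ^ 2)) := by
    refine intervalIntegral.integral_mono_on (by positivity) intervalIntegrable_const
      ((((continuous_sqrt_one_sub_mul_sin_sq m).const_mul _).add
      (continuous_one_div_sqrt_one_sub_mul_sin_sq hm)).intervalIntegrable _ _) fun θ _ => ?_
    have h0 := sqrt_pos.2 (one_sub_mul_sin_sq_pos hm θ)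
    set D := √(1 - m * sin θ ^ 2)
    have : t ^ 2 * D + 1 / D - 2 * t = (t * D - 1) ^ 2 / D := by field_simp; ring
    have : 0 ≤ (t * D - 1) ^ 2 / D := by positivity
    linarith
  rw [intervalIntegral.integral_add
    (((continuous_sqrt_one_sub_mul_sin_sq m).const_mul _).intervalIntegrable _ _)
    ((continuous_one_div_sqrt_one_sub_mul_sin_sq hm).intervalIntegrable _ _),
    intervalIntegral.integral_const, intervalIntegral.integral_const_mul] at h
  change _ ≤ t ^ 2 * paramE m + paramK m at h
  have h1 : t * paramE m = π / 2 := by rw [ht]; field_simp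
  simp only [smul_eq_mul, sub_zero] at h
  nlinarith

theorem paramE_le_paramK {m : ℝ} (hm0 : 0 ≤ m) (hm : m < 1) : paramE m ≤ paramK m := by
  refine intervalIntegral.integral_mono_on (by positivity)
    ((continuous_sqrt_one_sub_mul_sin_sq m).intervalIntegrable _ _)
    ((continuous_one_div_sqrt_one_sub_mul_sin_sq hm).intervalIntegrable _ _) fun θ _ => ?_
  have h0 := sqrt_pos.2 (one_sub_mul_sin_sq_pos hm θ)
  rw [le_div_iff₀ h0, mul_self_sqrt (one_sub_mul_sin_sq_pos hm θ).le]
  nlinarith [sq_nonneg (sin θ)]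

theorem continuousAt_paramK {m : ℝ} (hm : m < 1) : ContinuousAt paramK m :=
  (hasDerivAt_paramK_aux hm).continuousAt

/-- Legendre's relation. -/
theorem legendre_relation {m : ℝ} (hm0 : 0 < m) (hm : m < 1) :
    paramE m * paramK (1 - m) + paramE (1 - m) * paramK m - paramK m * paramK (1 - m) = π / 2 := by
  set L : ℝ → ℝ := fun m =>
    paramE m * paramK (1 - m) + paramE (1 - m) * paramK m - paramK m * paramK (1 - m) with hL
  have hd : ∀ x ∈ Ioo (0:ℝ) 1, HasDerivAt L 0 x := by
    intro x ⟨hx0, hx1⟩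
    have h1 : HasDerivAt (fun y : ℝ => 1 - y) (-1) x := by
      simpa using (hasDerivAt_id x).const_sub 1
    have e := hasDerivAt_paramE hx0.ne' hx1
    have k := hasDerivAt_paramK hx0.ne' hx1
    have e' := (hasDerivAt_paramE (m := 1 - x) (by linarith) (by linarith)).comp x h1
    have k' := (hasDerivAt_paramK (m := 1 - x) (by linarith) (by linarith)).comp x h1
    refine (((e.mul k').add (e'.mul k)).sub (k.mul k')).congr_deriv ?_
    have : 1 - x ≠ 0 := by linarith
    simp only [Function.comp_apply, sub_sub_cancel]
    field_simp
    ring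
  have hconst : ∀ y ∈ Ioo (0:ℝ) 1, L y = L m := fun y hy =>
    isOpen_Ioo.is_const_of_deriv_eq_zero isPreconnected_Ioo
      (fun x hx => (hd x hx).differentiableAt.differentiableWithinAt)
      (fun x hx => (hd x hx).deriv) hy ⟨hm0, hm⟩
  have hev : ∀ᶠ y in 𝓝[>] (0:ℝ), y ∈ Ioo (0:ℝ) 1 := Ioo_mem_nhdsGT one_pos
  have hlim1 : Tendsto L (𝓝[>] 0) (𝓝 (L m)) :=
    tendsto_const_nhds.congr' (hev.mono fun y hy => (hconst y hy).symm)
  have hprod : Tendsto (fun y => (paramE y - paramK y) * paramK (1 - y)) (𝓝[>] 0) (𝓝 0) := by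
    have hb : Tendsto (fun y : ℝ => (π / 2) ^ 2 * (√y / √(1 - y))) (𝓝[>] 0) (𝓝 0) := by
      have : ContinuousAt (fun y : ℝ => (π / 2) ^ 2 * (√y / √(1 - y))) 0 := by
        refine ContinuousAt.mul (by fun_prop) (ContinuousAt.div (by fun_prop) (by fun_prop) ?_)
        simp
      have h := this.tendsto
      simp only [sqrt_zero, zero_div, mul_zero] at h
      exact h.mono_left nhdsWithin_le_nhds
    refine squeeze_zero_norm' ?_ hb
    filter_upwards [hev] with y hy
    have hEK := paramE_le_paramK hy.1.le hy.2
    have hKE := one_sub_mul_paramK_le hy.1.le hy.2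
    have hK := paramK_le hy.1.le hy.2
    have hK' := paramK_le (m := 1 - y) (by linarith [hy.2]) (by linarith [hy.1])
    have hE := one_le_paramE hy.2.le
    have hEK' := paramE_le_paramK (m := 1 - y) (by linarith [hy.2]) (by linarith [hy.1])
    have hE' := one_le_paramE (m := 1 - y) (by linarith [hy.1])
    rw [sub_sub_cancel] at hK'
    rw [norm_mul, norm_of_nonpos (by linarith), norm_of_nonneg (by linarith)]
    have hy0 := sqrt_pos.2 hy.1
    calc -(paramE y - paramK y) * paramK (1 - y)
        ≤ (y * ((π / 2) / √(1 - y))) * ((π / 2) / √y) := by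
          have h1 := mul_le_mul_of_nonneg_left hK hy.1.le
          exact mul_le_mul (by linarith) hK' (by linarith) (by linarith [hy.1])
      _ = (π / 2) ^ 2 * (√y / √(1 - y)) := by
          nth_rewrite 1 [← sq_sqrt hy.1.le]
          field_simp
  have hlim2 : Tendsto L (𝓝[>] 0) (𝓝 (0 + 1 * (π / 2))) := by
    have he : Tendsto (fun y => paramE (1 - y)) (𝓝[>] 0) (𝓝 1) := by
      have : Continuous fun y : ℝ => paramE (1 - y) := continuous_paramE.comp (by fun_prop)
      have h := this.tendsto 0
      rw [sub_zero, paramE_one] at h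
      exact h.mono_left nhdsWithin_le_nhds
    have hk : Tendsto paramK (𝓝[>] 0) (𝓝 (π / 2)) := by
      have h := (continuousAt_paramK one_pos).tendsto
      rw [paramK_zero] at h
      exact h.mono_left nhdsWithin_le_nhds
    refine (hprod.add (he.mul hk)).congr fun y => ?_
    simp only [hL]
    ring
  have := tendsto_nhds_unique hlim1 hlim2
  simpa using this

theorem hasDerivAt_complementary_div_paramE {m : ℝ} (hm0 : 0 < m) (hm : m < 1) :
    HasDerivAt (fun m => (paramK (1 - m) - paramE (1 - m)) / paramE m)
      (-π / (4 * m * paramE m ^ 2)) m := by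
  have h1 : HasDerivAt (fun y : ℝ => 1 - y) (-1) m := by
    simpa using (hasDerivAt_id m).const_sub 1
  have e := hasDerivAt_paramE hm0.ne' hm
  have e' := (hasDerivAt_paramE (m := 1 - m) (by linarith) (by linarith)).comp m h1
  have k' := (hasDerivAt_paramK (m := 1 - m) (by linarith) (by linarith)).comp m h1
  have hE := one_le_paramE hm.le
  have hE0 : paramE m ≠ 0 := by linarith
  refine ((k'.sub e').div e hE0).congr_deriv ?_
  have : 1 - m ≠ 0 := by linarith
  have hleg := legendre_relation hm0 hm
  simp only [Function.comp_apply, sub_sub_cancel, Pi.sub_apply]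
  field_simp
  linear_combination (4 * m - 4) * hleg

theorem integral_sin_div_sqrt {m : ℝ} (hm0 : 0 < m) (hm : m < 1) :
    ∫ θ in (0:ℝ)..(π / 2), sin θ / √(1 - (1 - m) * sin θ ^ 2) =
      (log (1 + √(1 - m)) - log m / 2) / √(1 - m) := by
  set n := √(1 - m) with hn
  have hn0 : 0 < n := sqrt_pos.2 (by linarith)
  have hn2 : n ^ 2 = 1 - m := sq_sqrt (by linarith)
  have hpos : ∀ θ, 0 < 1 - (1 - m) * sin θ ^ 2 := one_sub_mul_sin_sq_pos (by linarith)
  have hnc : ∀ θ, 0 < n * cos θ + √(1 - (1 - m) * sin θ ^ 2) := fun θ => by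
    have : |n * cos θ| < √(1 - (1 - m) * sin θ ^ 2) := by
      refine lt_sqrt_of_sq_lt ?_
      rw [sq_abs, mul_pow, hn2, cos_sq']
      linarith
    linarith [(abs_lt.1 this).1]
  have hd : ∀ θ : ℝ, HasDerivAt
      (fun θ => -(log (n * cos θ + √(1 - (1 - m) * sin θ ^ 2)) / n))
      (sin θ / √(1 - (1 - m) * sin θ ^ 2)) θ := by
    intro θ
    have h2 := ((((hasDerivAt_sin θ).fun_pow 2).const_mul (1 - m)).const_sub 1).sqrt (hpos θ).ne'
    have h := (((((hasDerivAt_cos θ).const_mul n).fun_add h2).log (hnc θ).ne').div_const n).fun_neg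
    refine h.congr_deriv ?_
    have h0 := (sqrt_pos.2 (hpos θ)).ne'
    have h1 := (hnc θ).ne'
    rw [← hn2] at h0 h1 ⊢
    set D := √(1 - n ^ 2 * sin θ ^ 2)
    simp only [Nat.cast_ofNat, Nat.add_one_sub_one, pow_one]
    field_simp
    ring
  rw [intervalIntegral.integral_eq_sub_of_hasDerivAt (fun θ _ => hd θ)]
  · have : 1 - (1 - m) * sin (π / 2) ^ 2 = m := by rw [sin_pi_div_two]; ring
    rw [this, cos_pi_div_two, mul_zero, zero_add, log_sqrt hm0.le]
    simp only [cos_zero, sin_zero, mul_one, ne_eq, OfNat.ofNat_ne_zero, not_false_eq_true,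
      zero_pow, mul_zero, sub_zero, sqrt_one]
    rw [add_comm n 1]
    ring
  · exact (continuous_sin.div (by fun_prop)
      fun θ => (sqrt_pos.2 (hpos θ)).ne').intervalIntegrable _ _

theorem integral_cos_div_one_add_sin :
    ∫ θ in (0:ℝ)..(π / 2), cos θ / (1 + sin θ) = log 2 := by
  have hpos : ∀ θ ∈ uIcc (0:ℝ) (π / 2), 0 < 1 + sin θ := fun θ hθ => by
    rw [uIcc_of_le (by positivity)] at hθ
    have := sin_nonneg_of_nonneg_of_le_pi hθ.1 (by linarith [hθ.2, pi_pos])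
    linarith
  rw [intervalIntegral.integral_eq_sub_of_hasDerivAt (f := fun θ => log (1 + sin θ))
    (fun θ hθ => ((hasDerivAt_sin θ).const_add 1).log (hpos θ hθ).ne')]
  · norm_num
  · exact (ContinuousOn.div (by fun_prop) (by fun_prop)
      fun θ hθ => (hpos θ hθ).ne').intervalIntegrable

theorem tendsto_integral_one_sub_sin_div_sqrt :
    Tendsto (fun m : ℝ => ∫ θ in (0:ℝ)..(π / 2), (1 - sin θ) / √(1 - (1 - m) * sin θ ^ 2))
      (𝓝[>] 0) (𝓝 (log 2)) := by
  rw [← integral_cos_div_one_add_sin]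
  have hev : ∀ᶠ y in 𝓝[>] (0:ℝ), y ∈ Ioo (0:ℝ) 1 := Ioo_mem_nhdsGT one_pos
  refine intervalIntegral.tendsto_integral_filter_of_dominated_convergence (fun _ => (1:ℝ))
    ?_ ?_ intervalIntegrable_const ?_
  · filter_upwards [hev] with m hm
    exact ((by fun_prop : Continuous fun θ : ℝ => 1 - sin θ).div (by fun_prop)
      fun θ => (sqrt_pos.2 (one_sub_mul_sin_sq_pos (by linarith [hm.1]) θ)).ne').aestronglyMeasurable
  · filter_upwards [hev] with m hm
    refine Eventually.of_forall fun θ hθ => ?_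
    rw [uIoc_of_le (by positivity)] at hθ
    have hs := sin_nonneg_of_nonneg_of_le_pi hθ.1.le (by linarith [hθ.2, pi_pos])
    have hs1 := sin_le_one θ
    have h0 := sqrt_pos.2 (one_sub_mul_sin_sq_pos (m := 1 - m) (by linarith [hm.1]) θ)
    rw [norm_div, norm_of_nonneg (by linarith), norm_of_nonneg h0.le, div_le_one h0]
    refine le_sqrt_of_sq_le ?_
    nlinarith [mul_nonneg hm.1.le (sq_nonneg (sin θ))]
  · refine Eventually.of_forall fun θ hθ => ?_
    rw [uIoc_of_le (by positivity)] at hθ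
    rcases hθ.2.eq_or_lt with rfl | hlt
    · simp
    have hc : 0 < cos θ := cos_pos_of_mem_Ioo ⟨by linarith [hθ.1], hlt⟩
    have hs := sin_nonneg_of_nonneg_of_le_pi hθ.1.le (by linarith [hθ.2, pi_pos])
    have hsq : √(1 - (1 - 0) * sin θ ^ 2) = cos θ := by
      rw [sub_zero, one_mul, ← cos_sq', sqrt_sq hc.le]
    have hcont : ContinuousAt (fun m : ℝ => (1 - sin θ) / √(1 - (1 - m) * sin θ ^ 2)) 0 :=
      ContinuousAt.div (by fun_prop) (by fun_prop) (by rw [hsq]; exact hc.ne')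
    have h := hcont.tendsto
    rw [hsq] at h
    have heq : (1 - sin θ) / cos θ = cos θ / (1 + sin θ) := by
      rw [div_eq_div_iff hc.ne' (by linarith)]
      nlinarith [sin_sq_add_cos_sq θ]
    rw [heq] at h
    exact h.mono_left nhdsWithin_le_nhds

/-- The logarithmic asymptotics of the complementary integral of the first kind. -/
theorem tendsto_paramK_one_sub_add_log :
    Tendsto (fun m : ℝ => paramK (1 - m) + log m / 2) (𝓝[>] 0) (𝓝 (log 4)) := by
  have hev : ∀ᶠ y in 𝓝[>] (0:ℝ), y ∈ Ioo (0:ℝ) 1 := Ioo_mem_nhdsGT one_pos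
  have hmain : Tendsto (fun m : ℝ => log (1 + √(1 - m)) / √(1 - m) -
      m * log m / (2 * (√(1 - m) * (1 + √(1 - m))))) (𝓝[>] 0) (𝓝 (log 2)) := by
    have h1 : √(1 - (0:ℝ)) = 1 := by simp
    have hcont : ContinuousAt (fun m : ℝ => log (1 + √(1 - m)) / √(1 - m) -
        m * log m / (2 * (√(1 - m) * (1 + √(1 - m))))) 0 := by
      refine (ContinuousAt.div (ContinuousAt.log (by fun_prop) ?_) (by fun_prop) ?_).sub
        (ContinuousAt.div continuous_mul_log.continuousAt (by fun_prop) ?_) <;> rw [h1] <;> norm_num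
    have h := hcont.tendsto
    rw [h1] at h
    norm_num at h
    exact h.mono_left nhdsWithin_le_nhds
  have h4 : log 4 = log 2 + log 2 := by
    rw [← log_mul (by norm_num) (by norm_num)]; norm_num
  rw [h4]
  refine (hmain.add tendsto_integral_one_sub_sin_div_sqrt).congr' ?_
  filter_upwards [hev] with m hm
  have hpos : ∀ θ, 0 < 1 - (1 - m) * sin θ ^ 2 := one_sub_mul_sin_sq_pos (by linarith [hm.1])
  have hsplit : paramK (1 - m) = (∫ θ in (0:ℝ)..(π / 2), sin θ / √(1 - (1 - m) * sin θ ^ 2)) +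
      ∫ θ in (0:ℝ)..(π / 2), (1 - sin θ) / √(1 - (1 - m) * sin θ ^ 2) := by
    rw [← intervalIntegral.integral_add]
    · refine intervalIntegral.integral_congr fun θ _ => ?_
      ring
    · exact (continuous_sin.div (by fun_prop)
        fun θ => (sqrt_pos.2 (hpos θ)).ne').intervalIntegrable _ _
    · exact ((by fun_prop : Continuous fun θ : ℝ => 1 - sin θ).div (by fun_prop)
        fun θ => (sqrt_pos.2 (hpos θ)).ne').intervalIntegrable _ _
  rw [hsplit, integral_sin_div_sqrt hm.1 hm.2]
  have hn0 : 0 < √(1 - m) := sqrt_pos.2 (by linarith [hm.2])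
  have hn2 : √(1 - m) ^ 2 = 1 - m := sq_sqrt (by linarith [hm.2])
  set n := √(1 - m)
  have hm' : m = 1 - n ^ 2 := by linarith
  have : m * log m / (2 * (n * (1 + n))) = (1 - n) * log m / (2 * n) := by
    nth_rewrite 1 [hm']
    field_simp
    ring
  rw [this]
  generalize (∫ θ in (0:ℝ)..(π / 2), (1 - sin θ) / √(1 - (1 - m) * sin θ ^ 2)) = I
  field_simp
  ring

/-- The difference between `𝒥` and its logarithmic approximation, in terms of `m = k²`. -/
noncomputable def logError (m : ℝ) : ℝ :=
  π / 2 * ((paramK (1 - m) - paramE (1 - m)) / paramE m) - log (paramE m) + log m / 2 +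
    (1 + log (π / 2) - log 4)

theorem hasDerivAt_logError {m : ℝ} (hm0 : 0 < m) (hm : m < 1) :
    HasDerivAt logError
      ((paramK m * paramE m - (π / 2) ^ 2) / (2 * m * paramE m ^ 2)) m := by
  have hE := one_le_paramE hm.le
  have hE0 : paramE m ≠ 0 := by linarith
  have h1 := (hasDerivAt_complementary_div_paramE hm0 hm).const_mul (π / 2)
  have h2 := (hasDerivAt_paramE hm0.ne' hm).log hE0
  have h3 := (hasDerivAt_log hm0.ne').div_const 2
  refine (((h1.sub h2).add h3).add_const _).congr_deriv ?_
  field_simp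
  ring

theorem tendsto_logError : Tendsto logError (𝓝[>] 0) (𝓝 0) := by
  have hev : ∀ᶠ y in 𝓝[>] (0:ℝ), y ∈ Ioo (0:ℝ) 1 := Ioo_mem_nhdsGT one_pos
  have hp : 0 < π / 2 := by positivity
  have he : Tendsto paramE (𝓝[>] 0) (𝓝 (π / 2)) := by
    have h := continuous_paramE.tendsto 0
    rw [paramE_zero] at h
    exact h.mono_left nhdsWithin_le_nhds
  have he' : Tendsto (fun y => paramE (1 - y)) (𝓝[>] 0) (𝓝 1) := by
    have : Continuous fun y : ℝ => paramE (1 - y) := continuous_paramE.comp (by fun_prop)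
    have h := this.tendsto 0
    rw [sub_zero, paramE_one] at h
    exact h.mono_left nhdsWithin_le_nhds
  have hml : Tendsto (fun m => (paramE m - π / 2) * log m) (𝓝[>] 0) (𝓝 0) := by
    have hb : Tendsto (fun y : ℝ => (π / 2) * |y * log y|) (𝓝[>] 0) (𝓝 0) := by
      have hc : Continuous fun y : ℝ => (π / 2) * |y * log y| :=
        continuous_const.mul continuous_mul_log.abs
      have h := hc.tendsto 0
      simp only [zero_mul, abs_zero, mul_zero] at h
      exact h.mono_left nhdsWithin_le_nhds
    refine squeeze_zero_norm' ?_ hb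
    filter_upwards [hev] with y hy
    have h1 := paramE_le hy.1.le
    have h2 := one_sub_mul_paramK_le hy.1.le hy.2
    have h3 := sq_le_paramK_mul_paramE hy.2
    have h4 : π / 2 ≤ paramK y := by
      have := one_le_paramE hy.2.le
      nlinarith
    rw [norm_mul, norm_of_nonpos (by linarith), abs_mul, abs_of_pos hy.1, ← mul_assoc,
      norm_eq_abs]
    gcongr
    nlinarith [hy.2]
  have h := (((tendsto_paramK_one_sub_add_log.sub he').div he hp.ne').const_mul (π / 2)).add
    (((hml.div he hp.ne').const_mul (1 / 2)).sub (he.log hp.ne'))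
  have h' := h.add_const (1 + log (π / 2) - log 4)
  have hz : π / 2 * ((log 4 - 1) / (π / 2)) + (1 / 2 * (0 / (π / 2)) - log (π / 2)) +
      (1 + log (π / 2) - log 4) = 0 := by field_simp; ring
  rw [hz] at h'
  refine h'.congr' ?_
  filter_upwards [hev] with m hm
  have hE0 : paramE m ≠ 0 := (one_pos.trans_le (one_le_paramE hm.2.le)).ne'
  simp only [logError, Pi.div_apply]
  field_simp
  ring

theorem MonotoneOn.le_of_tendsto_nhdsGT {f : ℝ → ℝ} {a b c : ℝ} (hf : MonotoneOn f (Ioo a b))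
    (hlim : Tendsto f (𝓝[>] a) (𝓝 c)) {x : ℝ} (hx : x ∈ Ioo a b) : c ≤ f x := by
  refine le_of_tendsto hlim ?_
  filter_upwards [Ioo_mem_nhdsGT hx.1] with y hy
  exact hf ⟨hy.1, hy.2.trans hx.2⟩ hx hy.2.le

theorem logError_nonneg {m : ℝ} (hm0 : 0 < m) (hm : m < 1) : 0 ≤ logError m := by
  refine MonotoneOn.le_of_tendsto_nhdsGT (a := 0) (b := 1) ?_ tendsto_logError ⟨hm0, hm⟩
  refine monotoneOn_of_deriv_nonneg (convex_Ioo 0 1)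
    (fun x hx => (hasDerivAt_logError hx.1 hx.2).continuousAt.continuousWithinAt) ?_ ?_ <;>
    rw [interior_Ioo] <;> intro x hx
  · exact (hasDerivAt_logError hx.1 hx.2).differentiableAt.differentiableWithinAt
  · rw [(hasDerivAt_logError hx.1 hx.2).deriv]
    have := sq_le_paramK_mul_paramE hx.2
    have := hx.1
    exact div_nonneg (by linarith) (by positivity)

theorem logError_le {m : ℝ} (hm0 : 0 < m) (hm : m < 1) :
    logError m ≤ π ^ 2 / 8 * ((π / 2) ^ 2 * (m / paramE m ^ 2)) := by
  set G : ℝ → ℝ := fun m => π ^ 2 / 8 * ((π / 2) ^ 2 * (m / paramE m ^ 2)) - logError m with hG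
  have hd : ∀ x ∈ Ioo (0:ℝ) 1, HasDerivAt G
      (π ^ 2 / 8 * ((π / 2) ^ 2 * (paramK x / paramE x ^ 3)) -
        (paramK x * paramE x - (π / 2) ^ 2) / (2 * x * paramE x ^ 2)) x := by
    intro x ⟨hx0, hx1⟩
    have hE0 : paramE x ≠ 0 := (one_pos.trans_le (one_le_paramE hx1.le)).ne'
    have h := (((hasDerivAt_id x).fun_div ((hasDerivAt_paramE hx0.ne' hx1).fun_pow 2)
      (pow_ne_zero 2 hE0)).const_mul ((π / 2) ^ 2)).const_mul (π ^ 2 / 8)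
    refine (h.sub (hasDerivAt_logError hx0 hx1)).congr_deriv ?_
    congr 3
    rw [id_eq]
    field_simp
    ring
  suffices 0 ≤ G m by simpa [hG] using this
  refine MonotoneOn.le_of_tendsto_nhdsGT (a := 0) (b := 1) ?_ ?_ ⟨hm0, hm⟩
  · refine monotoneOn_of_deriv_nonneg (convex_Ioo 0 1)
      (fun x hx => (hd x hx).continuousAt.continuousWithinAt) ?_ ?_ <;>
      rw [interior_Ioo] <;> intro x hx
    · exact (hd x hx).differentiableAt.differentiableWithinAt
    · rw [(hd x hx).deriv, sub_nonneg]
      have hE := one_le_paramE hx.2.le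
      have hEle := paramE_le hx.1.le
      have hK := one_sub_mul_paramK_le hx.1.le hx.2
      have hEK := paramE_le_paramK hx.1.le hx.2
      have hx0 := hx.1
      set e := paramE x
      set k := paramK x
      have hp : 1 < π / 2 := by linarith [pi_gt_three]
      have hπ : π = 2 * (π / 2) := by ring
      set p := π / 2
      have key : e * (k * e - p ^ 2) ≤ p ^ 4 * x * k := by
        have h1 : e ^ 2 * k ≤ p ^ 2 * k := by gcongr; linarith
        have h2 : (1 - x) * k * p ^ 2 ≤ e * p ^ 2 := by gcongr
        have h3 : x * k * p ^ 2 * 1 ≤ x * k * p ^ 2 * p ^ 2 := by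
          have : 0 ≤ k := by linarith
          gcongr
          nlinarith
        linarith
      have e1 : (k * e - p ^ 2) / (2 * x * e ^ 2) = (e * (k * e - p ^ 2)) / (2 * x * e ^ 3) := by
        field_simp
      have e2 : π ^ 2 / 8 * (p ^ 2 * (k / e ^ 3)) = (p ^ 4 * x * k) / (2 * x * e ^ 3) := by
        rw [hπ]
        field_simp
        ring
      rw [e1, e2]
      gcongr
  · have h1 : Tendsto (fun m => π ^ 2 / 8 * ((π / 2) ^ 2 * (m / paramE m ^ 2))) (𝓝[>] 0)
        (𝓝 0) := by
      have hc : ContinuousAt (fun m => π ^ 2 / 8 * ((π / 2) ^ 2 * (m / paramE m ^ 2))) 0 := by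
        refine continuousAt_const.mul (continuousAt_const.mul
          (continuousAt_id.div (continuous_paramE.pow 2).continuousAt ?_))
        rw [paramE_zero]
        positivity
      have h := hc.tendsto
      simp only [zero_div, mul_zero] at h
      exact h.mono_left nhdsWithin_le_nhds
    simpa using h1.sub tendsto_logError

theorem ellE_eq_paramE (k : ℝ) : ellE k = paramE (k ^ 2) := by
  have himg : sin '' Ioo 0 (π / 2) = Ioo 0 1 := by
    ext y
    constructor
    · rintro ⟨θ, hθ, rfl⟩
      refine ⟨sin_pos_of_pos_of_lt_pi hθ.1 (by linarith [hθ.2, pi_pos]), ?_⟩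
      rw [← sin_pi_div_two]
      exact sin_lt_sin_of_lt_of_le_pi_div_two (by linarith [hθ.1, pi_pos]) le_rfl hθ.2
    · intro hy
      exact ⟨arcsin y, ⟨arcsin_pos.2 hy.1, arcsin_lt_pi_div_two.2 hy.2⟩,
        sin_arcsin (by linarith [hy.1]) hy.2.le⟩
  have hinj : InjOn sin (Ioo 0 (π / 2)) := injOn_sin.mono
    (Ioo_subset_Icc_self.trans (Icc_subset_Icc_left (by linarith [pi_pos])))
  rw [ellE, paramE, intervalIntegral.integral_of_le zero_le_one, integral_Ioc_eq_integral_Ioo,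
    ← himg, integral_image_eq_integral_abs_deriv_smul measurableSet_Ioo
      (fun θ _ => (hasDerivAt_sin θ).hasDerivWithinAt) hinj,
    intervalIntegral.integral_of_le (by positivity), integral_Ioc_eq_integral_Ioo]
  refine setIntegral_congr_fun measurableSet_Ioo fun θ hθ => ?_
  have hc : 0 < cos θ := cos_pos_of_mem_Ioo ⟨by linarith [hθ.1, pi_pos], hθ.2⟩
  rw [← cos_sq', sqrt_div' _ (sq_nonneg _), sqrt_sq hc.le, abs_of_pos hc, smul_eq_mul]
  field_simp

/-- The value `Φ(y)` solves `Ψ(k) = y`. -/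
theorem PhiFn_spec {y : ℝ} (hy0 : 0 < y) (hy1 : y < 1) :
    PhiFn y ∈ Ioo (0:ℝ) 1 ∧ PsiFn (PhiFn y) = y := by
  have hPsi : ∀ k, PsiFn k = k / paramE (k ^ 2) := fun k => by rw [PsiFn, ellE_eq_paramE]
  have hE : ∀ k ∈ Icc (0:ℝ) 1, 1 ≤ paramE (k ^ 2) := fun k hk =>
    one_le_paramE (pow_le_one₀ hk.1 hk.2)
  have hcont : ContinuousOn PsiFn (Icc 0 1) := by
    rw [show PsiFn = fun k => k / paramE (k ^ 2) from funext hPsi]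
    exact continuousOn_id.div (continuous_paramE.comp (continuous_pow 2)).continuousOn
      fun k hk => (one_pos.trans_le (hE k hk)).ne'
  have hmono : StrictMonoOn PsiFn (Icc 0 1) := by
    intro a ha b hb hab
    rw [hPsi, hPsi]
    have h1 : paramE (b ^ 2) ≤ paramE (a ^ 2) :=
      antitone_paramE (pow_le_pow_left₀ ha.1 hab.le 2)
    exact div_lt_div₀ hab h1 (ha.1.trans hab.le) (one_pos.trans_le (hE b hb))
  have h0 : PsiFn 0 = 0 := by simp [PsiFn]
  have h1 : PsiFn 1 = 1 := by rw [hPsi, one_pow, paramE_one, div_one]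
  obtain ⟨k, hk, hky⟩ := intermediate_value_Icc zero_le_one hcont
    (show y ∈ Icc (PsiFn 0) (PsiFn 1) by rw [h0, h1]; exact ⟨hy0.le, hy1.le⟩)
  have hset : {z : ℝ | z ∈ Icc (0:ℝ) 1 ∧ PsiFn z ≤ y} = Icc 0 k := by
    ext z
    constructor
    · rintro ⟨hz, hzy⟩
      exact ⟨hz.1, (hmono.le_iff_le hz hk).1 (hky ▸ hzy)⟩
    · intro hz
      have hz' : z ∈ Icc (0:ℝ) 1 := ⟨hz.1, hz.2.trans hk.2⟩
      exact ⟨hz', hky ▸ (hmono.le_iff_le hz' hk).2 hz.2⟩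
  have hPhi : PhiFn y = k := by rw [PhiFn, hset, csSup_Icc hk.1]
  rw [hPhi]
  refine ⟨⟨lt_of_le_of_ne hk.1 ?_, lt_of_le_of_ne hk.2 ?_⟩, hky⟩
  · rintro rfl
    linarith
  · rintro rfl
    linarith

theorem integral_one_div_mul_ellE_sq {k : ℝ} (hk : k ∈ Ioo (0:ℝ) 1) :
    π ^ 2 / 4 * ∫ t in k..(1:ℝ), 1 / (t * ellE t ^ 2) =
      π / 2 * ((paramK (1 - k ^ 2) - paramE (1 - k ^ 2)) / paramE (k ^ 2)) := by
  set H : ℝ → ℝ := fun m => (paramK (1 - m) - paramE (1 - m)) / paramE m with hH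
  have hE : ∀ t ∈ Icc k 1, paramE (t ^ 2) ≠ 0 := fun t ht =>
    (one_pos.trans_le (one_le_paramE (pow_le_one₀ (hk.1.le.trans ht.1) ht.2))).ne'
  have hcE : Continuous fun t : ℝ => paramE (t ^ 2) := continuous_paramE.comp (continuous_pow 2)
  have hint : IntervalIntegrable (fun t => 1 / (t * ellE t ^ 2)) volume k 1 := by
    simp only [ellE_eq_paramE]
    refine ContinuousOn.intervalIntegrable ?_
    rw [uIcc_of_le hk.2.le]
    exact continuousOn_const.div (continuousOn_id.mul (hcE.pow 2).continuousOn)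
      fun t ht => mul_ne_zero (hk.1.trans_le ht.1).ne' (pow_ne_zero 2 (hE t ht))
  have hcont : ContinuousOn (fun t : ℝ => -(2 / π) * H (t ^ 2)) (Icc k 1) := by
    refine continuousOn_const.mul (ContinuousOn.div (ContinuousOn.sub ?_ ?_)
      hcE.continuousOn hE)
    · intro t ht
      have : 1 - t ^ 2 < 1 := by nlinarith [hk.1.trans_le ht.1]
      exact (ContinuousAt.comp (g := paramK) (f := fun t : ℝ => 1 - t ^ 2)
        (continuousAt_paramK this) (by fun_prop)).continuousWithinAt
    · exact (continuous_paramE.comp (by fun_prop : Continuous fun t : ℝ => 1 - t ^ 2)).continuousOn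
  have hd : ∀ t ∈ Ioo k 1, HasDerivAt (fun t : ℝ => -(2 / π) * H (t ^ 2))
      (1 / (t * ellE t ^ 2)) t := by
    intro t ht
    have ht0 := hk.1.trans ht.1
    have hHd : HasDerivAt H _ (t ^ 2) := hasDerivAt_complementary_div_paramE (by positivity)
      (pow_lt_one₀ ht0.le ht.2 two_ne_zero)
    have h := (HasDerivAt.comp (h := fun t : ℝ => t ^ 2) t hHd (hasDerivAt_pow 2 t)).const_mul
      (-(2 / π))
    refine h.congr_deriv ?_
    have := hE t ⟨ht.1.le, ht.2.le⟩
    rw [ellE_eq_paramE]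
    have := pi_pos
    simp only [Nat.cast_ofNat, Nat.add_one_sub_one, pow_one]
    field_simp
    norm_num
  have hH1 : H 1 = 0 := by simp [hH, paramK_zero, paramE_zero]
  rw [intervalIntegral.integral_eq_sub_of_hasDerivAt_of_le hk.2.le hcont hd hint, one_pow, hH1]
  have := pi_pos
  field_simp
  ring

theorem Jcal_sub_log_eq {x : ℝ} (hx : 0 < x) (hx2 : x < π / 2) :
    ∃ m ∈ Ioo (0:ℝ) 1, x ^ 2 = (π / 2) ^ 2 * (m / paramE m ^ 2) ∧
      Jcal x - log (4 / (exp 1 * x)) = logError m := by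
  have hπ := pi_pos
  obtain ⟨hk, hPsi⟩ := PhiFn_spec (y := 2 * x / π) (by positivity)
    (by rw [div_lt_one hπ]; linarith)
  set k := PhiFn (2 * x / π) with hkdef
  rw [PsiFn, ellE_eq_paramE] at hPsi
  have hm1 : k ^ 2 < 1 := pow_lt_one₀ hk.1.le hk.2 two_ne_zero
  have hE : 0 < paramE (k ^ 2) := one_pos.trans_le (one_le_paramE hm1.le)
  have hk0 := hk.1
  have hxk : x = π / 2 * k / paramE (k ^ 2) := by
    field_simp at hPsi ⊢
    linarith
  refine ⟨k ^ 2, ⟨by positivity, hm1⟩, ?_, ?_⟩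
  · rw [hxk]
    field_simp
  · have hlog : log (4 / (exp 1 * x)) =
        log 4 - (1 + (log (π / 2) + log k - log (paramE (k ^ 2)))) := by
      rw [log_div (by norm_num) (by positivity), log_mul (exp_pos 1).ne' hx.ne', log_exp, hxk,
        log_div (by positivity) hE.ne', log_mul (by positivity) hk0.ne']
    rw [Jcal, ← hkdef, integral_one_div_mul_ellE_sq hk, hlog, logError, log_pow]
    push_cast
    ring

end

theorem stmt7 (x : ℝ) (hx : 0 < x) (hx2 : x < Real.pi / 2) :
    |Jcal x - Real.log (4/(Real.exp 1 * x))| ≤ Real.pi^2 * x^2 / 8 := by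
  obtain ⟨m, hm, hxm, hJ⟩ := Jcal_sub_log_eq hx hx2
  rw [hJ, abs_of_nonneg (logError_nonneg hm.1 hm.2), hxm]
  linarith [logError_le hm.1 hm.2]
end

section
/- For every real y with 0 < y ≤ 1, one has 0 ≤ ∫₀^y (π²/4 − E(t)²)/(t·E(t)²) dt ≤ π²y²/8. -/
open MeasureTheory

theorem hasDerivAt_arcsin_of_mem_Ioo {t : ℝ} (ht : t ∈ Set.Ioo (0:ℝ) 1) :
    HasDerivAt Real.arcsin (1 / Real.sqrt (1 - t^2)) t :=
  Real.hasDerivAt_arcsin (by linarith [ht.1]) ht.2.ne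

theorem intervalIntegrable_one_div_sqrt_one_sub_sq :
    IntervalIntegrable (fun t : ℝ => 1 / Real.sqrt (1 - t^2)) volume 0 1 := by
  rw [intervalIntegrable_iff_integrableOn_Ioc_of_le zero_le_one]
  exact intervalIntegral.integrableOn_deriv_of_nonneg Real.continuous_arcsin.continuousOn
    (fun t ht => hasDerivAt_arcsin_of_mem_Ioo ht) (fun t _ => by positivity)

theorem integral_one_div_sqrt_one_sub_sq :
    ∫ t in (0:ℝ)..1, 1 / Real.sqrt (1 - t^2) = Real.pi / 2 := by
  rw [intervalIntegral.integral_eq_sub_of_hasDerivAt_of_le zero_le_one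
    Real.continuous_arcsin.continuousOn (fun t ht => hasDerivAt_arcsin_of_mem_Ioo ht)
    intervalIntegrable_one_div_sqrt_one_sub_sq]
  simp

theorem ellE_integrand_le {k t : ℝ} (ht : t ∈ Set.Ioo (0:ℝ) 1) :
    Real.sqrt ((1 - k^2 * t^2) / (1 - t^2)) ≤ 1 / Real.sqrt (1 - t^2) := by
  have h : 0 < 1 - t^2 := by nlinarith [ht.1, ht.2]
  rw [Real.sqrt_div' _ h.le]
  gcongr
  rw [Real.sqrt_le_one]
  nlinarith [mul_nonneg (sq_nonneg k) (sq_nonneg t)]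

/-- Concavity of the square root, applied to `1 - k²t² = (1 - k²) + k² (1 - t²)`. -/
theorem le_ellE_integrand {k t : ℝ} (hk : k ∈ Set.Icc (0:ℝ) 1) (ht : t ∈ Set.Ioo (0:ℝ) 1) :
    (1 - k^2) * (1 / Real.sqrt (1 - t^2)) + k^2 ≤ Real.sqrt ((1 - k^2 * t^2) / (1 - t^2)) := by
  have h : 0 < 1 - t^2 := by nlinarith [ht.1, ht.2]
  have hs : 0 < Real.sqrt (1 - t^2) := Real.sqrt_pos.2 h
  have hss : Real.sqrt (1 - t^2) ^ 2 = 1 - t^2 := Real.sq_sqrt h.le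
  have hk2 : k^2 ≤ 1 := by nlinarith [hk.1, hk.2]
  rw [Real.sqrt_div' _ h.le, le_div_iff₀ hs]
  have heq : ((1 - k^2) * (1 / Real.sqrt (1 - t^2)) + k^2) * Real.sqrt (1 - t^2)
      = (1 - k^2) + k^2 * Real.sqrt (1 - t^2) := by
    field_simp
  rw [heq]
  apply Real.le_sqrt_of_sq_le
  have hprod : 0 ≤ k^2 * (1 - k^2) * (1 - Real.sqrt (1 - t^2))^2 :=
    mul_nonneg (mul_nonneg (sq_nonneg k) (by linarith)) (sq_nonneg _)
  nlinarith [hprod, hss]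

theorem intervalIntegrable_ellE_integrand (k : ℝ) :
    IntervalIntegrable (fun t : ℝ => Real.sqrt ((1 - k^2 * t^2) / (1 - t^2))) volume 0 1 := by
  have hg := intervalIntegrable_one_div_sqrt_one_sub_sq
  rw [intervalIntegrable_iff_integrableOn_Ioo_of_le zero_le_one] at hg ⊢
  refine Integrable.mono' hg (by fun_prop : Measurable _).aestronglyMeasurable ?_
  filter_upwards [ae_restrict_mem measurableSet_Ioo] with t ht
  rw [Real.norm_of_nonneg (Real.sqrt_nonneg _)]
  exact ellE_integrand_le ht

theorem ellE_le_pi_div_two (k : ℝ) : ellE k ≤ Real.pi / 2 := by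
  rw [ellE, ← integral_one_div_sqrt_one_sub_sq]
  exact intervalIntegral.integral_mono_on_of_le_Ioo zero_le_one
    (intervalIntegrable_ellE_integrand k) intervalIntegrable_one_div_sqrt_one_sub_sq
    fun t ht => ellE_integrand_le ht

theorem le_ellE {k : ℝ} (hk : k ∈ Set.Icc (0:ℝ) 1) :
    (1 - k^2) * (Real.pi / 2) + k^2 ≤ ellE k := by
  have hg := intervalIntegrable_one_div_sqrt_one_sub_sq.const_mul (1 - k^2)
  have hc : IntervalIntegrable (fun _ : ℝ => k^2) volume 0 1 := intervalIntegrable_const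
  have heq : (1 - k^2) * (Real.pi / 2) + k^2
      = ∫ t in (0:ℝ)..1, ((1 - k^2) * (1 / Real.sqrt (1 - t^2)) + k^2) := by
    rw [intervalIntegral.integral_add hg hc, intervalIntegral.integral_const_mul,
      integral_one_div_sqrt_one_sub_sq]
    simp
  rw [heq, ellE]
  exact intervalIntegral.integral_mono_on_of_le_Ioo zero_le_one (hg.add hc)
    (intervalIntegrable_ellE_integrand k) fun t ht => le_ellE_integrand hk ht

theorem ellE_pos {k : ℝ} (hk : k ∈ Set.Icc (0:ℝ) 1) : 0 < ellE k := by
  have hk2 : k^2 ≤ 1 := by nlinarith [hk.1, hk.2]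
  nlinarith [le_ellE hk, Real.pi_gt_three]

theorem pi_sq_div_four_le {k : ℝ} (hk : k ∈ Set.Icc (0:ℝ) 1) :
    Real.pi^2 / 4 ≤ ellE k ^ 2 * (1 + Real.pi^2 / 4 * k^2) := by
  obtain ⟨u, hu⟩ : ∃ u, u = k^2 := ⟨_, rfl⟩
  obtain ⟨a, ha⟩ : ∃ a, a = Real.pi / 2 := ⟨_, rfl⟩
  have hu0 : 0 ≤ u := hu ▸ sq_nonneg k
  have hu1 : u ≤ 1 := by rw [hu]; nlinarith [hk.1, hk.2]
  have ha1 : 1.57 ≤ a := by linarith [Real.pi_gt_d2]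
  have ha2 : a ≤ 1.575 := by linarith [Real.pi_lt_d2]
  have hE : (1 - u) * a + u ≤ ellE k := by rw [hu, ha]; exact le_ellE hk
  have hb : 0 ≤ (1 - u) * a + u := by nlinarith
  have hpi : Real.pi^2 / 4 = a^2 := by rw [ha]; ring
  rw [hpi, ← hu]
  have hconst : 2 * a * (a - 1) + 2 * a^3 * (a - 1) ≤ a^4 + (a - 1)^2 := by
    have h3 : a^3 * (2 - a) ≥ 1.6 := by
      have h2' : 2.46 ≤ a^2 := by nlinarith
      have h3' : 3.86 ≤ a^3 := by nlinarith
      nlinarith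
    nlinarith
  have hq : 0 ≤ u * (a^4 - 2 * a * (a - 1) + ((a - 1)^2 - 2 * a^3 * (a - 1)) * u
      + a^2 * (a - 1)^2 * u^2) := by
    refine mul_nonneg hu0 (add_nonneg ?_ (by positivity))
    have h4 : 2 * a * (a - 1) ≤ a^4 := by
      have h2' : 2.46 ≤ a^2 := by nlinarith
      nlinarith
    nlinarith [mul_nonneg (sub_nonneg.2 h4) (sub_nonneg.2 hu1),
      mul_nonneg (sub_nonneg.2 hconst) hu0]
  calc a^2 ≤ ((1 - u) * a + u)^2 * (1 + a^2 * u) := by linarith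
    _ ≤ ellE k ^ 2 * (1 + a^2 * u) := by gcongr

theorem stmt9 (y : ℝ) (hy : 0 < y) (hy1 : y ≤ 1) :
    0 ≤ ∫ t in (0:ℝ)..y, (Real.pi^2/4 - (ellE t)^2) / (t * (ellE t)^2) ∧
    ∫ t in (0:ℝ)..y, (Real.pi^2/4 - (ellE t)^2) / (t * (ellE t)^2) ≤ Real.pi^2 * y^2 / 8 := by
  have hmem : ∀ t ∈ Set.Ioc (0:ℝ) y, t ∈ Set.Icc (0:ℝ) 1 := fun t ht => ⟨ht.1.le, ht.2.trans hy1⟩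
  have hnonneg : ∀ t ∈ Set.Ioc (0:ℝ) y,
      0 ≤ (Real.pi^2/4 - (ellE t)^2) / (t * (ellE t)^2) := fun t ht => by
    have hE := ellE_pos (hmem t ht)
    have ht0 := ht.1
    refine div_nonneg ?_ (by positivity)
    nlinarith [ellE_le_pi_div_two t, Real.pi_pos]
  have hle : ∀ t ∈ Set.Ioc (0:ℝ) y,
      (Real.pi^2/4 - (ellE t)^2) / (t * (ellE t)^2) ≤ Real.pi^2 / 4 * t := fun t ht => by
    have hE := ellE_pos (hmem t ht)
    have ht0 := ht.1
    rw [div_le_iff₀ (by positivity)]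
    linarith [pi_sq_div_four_le (hmem t ht)]
  have hint : IntervalIntegrable (fun t : ℝ => Real.pi^2 / 4 * t) volume 0 y :=
    (by fun_prop : Continuous fun t : ℝ => Real.pi^2 / 4 * t).intervalIntegrable 0 y
  have hval : ∫ t in (0:ℝ)..y, Real.pi^2 / 4 * t = Real.pi^2 * y^2 / 8 := by
    rw [intervalIntegral.integral_const_mul, integral_id]
    ring
  rw [← hval, intervalIntegral.integral_of_le hy.le, intervalIntegral.integral_of_le hy.le]
  refine ⟨setIntegral_nonneg measurableSet_Ioc hnonneg, integral_mono_of_nonneg ?_ hint.1 ?_⟩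
  · filter_upwards [ae_restrict_mem measurableSet_Ioc] with t ht using hnonneg t ht
  · filter_upwards [ae_restrict_mem measurableSet_Ioc] with t ht using hle t ht
end

section
/- For every real x with 0 ≤ x < 1, one has E(x) − 1 ≤ (1 − x²) · ( (1/4)·ln(1/(1 − x²)) + ln 2 ). -/
open MeasureTheory

section EllipticBounds

/-- Tangent-line bound for the integrand of `ellE`. -/
lemma ellE_integrand_le_tangent {x t : ℝ} (hx1 : x ^ 2 ≤ 1) (ht0 : 0 ≤ t) (ht1 : t < 1) :
    Real.sqrt ((1 - x ^ 2 * t ^ 2) / (1 - t ^ 2)) ≤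
      1 + (1 - x ^ 2) * t ^ 2 / (2 * (1 - t ^ 2)) := by
  have hc : 0 < 1 - t ^ 2 := by nlinarith
  have hq : 0 ≤ 1 - x ^ 2 := by linarith
  have hw : (1 - x ^ 2 * t ^ 2) / (1 - t ^ 2) =
      1 + 2 * ((1 - x ^ 2) * t ^ 2 / (2 * (1 - t ^ 2))) := by
    field_simp
    ring
  have hw0 : 0 ≤ (1 - x ^ 2) * t ^ 2 / (2 * (1 - t ^ 2)) := by positivity
  rw [hw]
  apply Real.sqrt_le_iff.2
  constructor <;> nlinarith

/-- A bound for the integrand of `ellE` which stays integrable up to `t = 1`. -/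
lemma ellE_integrand_le_s10 {x t p : ℝ} (hp : 0 < p) (hpx : p ^ 2 = 1 - x ^ 2)
    (ht0 : 0 ≤ t) (ht1 : t < 1) :
    Real.sqrt ((1 - x ^ 2 * t ^ 2) / (1 - t ^ 2)) ≤
      1 + p ^ 2 * (t / (Real.sqrt (1 - t ^ 2) * (p + Real.sqrt (1 - t ^ 2)))) := by
  have hc : 0 < 1 - t ^ 2 := by nlinarith
  obtain ⟨c, hcdef⟩ : ∃ c, c = Real.sqrt (1 - t ^ 2) := ⟨_, rfl⟩
  have hc0 : 0 < c := hcdef ▸ Real.sqrt_pos.2 hc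
  have hc2 : 1 - t ^ 2 = c ^ 2 := by rw [hcdef, Real.sq_sqrt hc.le]
  rw [← hcdef]
  apply Real.sqrt_le_iff.2
  refine ⟨by positivity, ?_⟩
  have hnum : 1 - x ^ 2 * t ^ 2 = c ^ 2 + p ^ 2 * t ^ 2 := by rw [← hc2, hpx]; ring
  rw [hnum, hc2]
  have key : (1 + p ^ 2 * (t / (c * (p + c)))) ^ 2 - (c ^ 2 + p ^ 2 * t ^ 2) / c ^ 2 =
      p ^ 2 * t * (2 * c * p * (1 - t) + c ^ 2 * (2 - t)) / (c ^ 2 * (p + c) ^ 2) := by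
    field_simp
    ring
  have h1 : 0 ≤ 1 - t := by linarith
  have h2 : 0 ≤ 2 - t := by linarith
  have : 0 ≤ p ^ 2 * t * (2 * c * p * (1 - t) + c ^ 2 * (2 - t)) / (c ^ 2 * (p + c) ^ 2) := by
    positivity
  linarith

lemma hasDerivAt_neg_log_add_sqrt {p t : ℝ} (hp : 0 < p) (ht : 0 < 1 - t ^ 2) :
    HasDerivAt (fun t : ℝ => -Real.log (p + Real.sqrt (1 - t ^ 2)))
      (t / (Real.sqrt (1 - t ^ 2) * (p + Real.sqrt (1 - t ^ 2)))) t := by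
  have hs : 0 < Real.sqrt (1 - t ^ 2) := Real.sqrt_pos.2 ht
  have h1 : HasDerivAt (fun t : ℝ => 1 - t ^ 2) (-(2 * t)) t := by
    simpa using (hasDerivAt_pow 2 t).const_sub 1
  have h2 := (((h1.sqrt ht.ne').const_add p).log (by positivity)).neg
  refine h2.congr_deriv ?_
  field_simp

lemma continuousOn_neg_log_add_sqrt {p : ℝ} (hp : 0 < p) (s : Set ℝ) :
    ContinuousOn (fun t : ℝ => -Real.log (p + Real.sqrt (1 - t ^ 2))) s := by
  apply Continuous.continuousOn
  apply Continuous.neg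
  apply Continuous.log
  · fun_prop
  · intro t
    positivity

lemma integrableOn_ellE_integrand {x : ℝ} (hx : x ^ 2 < 1) :
    IntegrableOn (fun t => Real.sqrt ((1 - x ^ 2 * t ^ 2) / (1 - t ^ 2))) (Set.Icc 0 1) := by
  have hq : 0 < 1 - x ^ 2 := by linarith
  obtain ⟨p, hp, hpx⟩ : ∃ p : ℝ, 0 < p ∧ p ^ 2 = 1 - x ^ 2 :=
    ⟨Real.sqrt (1 - x ^ 2), Real.sqrt_pos.2 hq, Real.sq_sqrt hq.le⟩
  rw [integrableOn_Icc_iff_integrableOn_Ioo]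
  have hint : IntegrableOn
      (fun t : ℝ => t / (Real.sqrt (1 - t ^ 2) * (p + Real.sqrt (1 - t ^ 2)))) (Set.Ioo 0 1) := by
    refine (intervalIntegral.integrableOn_deriv_of_nonneg
      (continuousOn_neg_log_add_sqrt hp (Set.Icc 0 1)) (fun t ht => ?_) (fun t ht => ?_)).mono_set
      Set.Ioo_subset_Ioc_self
    · exact hasDerivAt_neg_log_add_sqrt hp (by nlinarith [ht.1, ht.2])
    · have := ht.1.le
      positivity
  have hbound : IntegrableOn (fun t : ℝ => 1 + p ^ 2 *
      (t / (Real.sqrt (1 - t ^ 2) * (p + Real.sqrt (1 - t ^ 2))))) (Set.Ioo 0 1) :=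
    (integrableOn_const (by simp)).add (hint.const_mul _)
  refine Integrable.mono' hbound ?_ ?_
  · exact Measurable.aestronglyMeasurable (by fun_prop)
  · filter_upwards [ae_restrict_mem measurableSet_Ioo] with t ht
    rw [Real.norm_of_nonneg (Real.sqrt_nonneg _)]
    exact ellE_integrand_le_s10 hp hpx ht.1.le ht.2

lemma integral_ellE_integrand_le_left {x a : ℝ} (hx : x ^ 2 < 1) (ha0 : 0 ≤ a) (ha1 : a < 1) :
    ∫ t in (0:ℝ)..a, Real.sqrt ((1 - x ^ 2 * t ^ 2) / (1 - t ^ 2)) ≤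
      a + (1 - x ^ 2) / 2 * ((Real.log (1 + a) - Real.log (1 - a)) / 2 - a) := by
  have hderiv : ∀ t : ℝ, 0 ≤ t → t < 1 → HasDerivAt (fun t : ℝ =>
      t + (1 - x ^ 2) / 2 * ((Real.log (1 + t) - Real.log (1 - t)) / 2 - t))
      (1 + (1 - x ^ 2) * t ^ 2 / (2 * (1 - t ^ 2))) t := by
    intro t ht0 ht1
    have h1 : 0 < 1 - t := by linarith
    have h2 : 0 < 1 + t := by linarith
    have hl1 := ((hasDerivAt_id t).const_add 1).log h2.ne'
    have hl2 := ((hasDerivAt_id t).const_sub 1).log h1.ne'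
    refine ((hasDerivAt_id t).add
      ((((hl1.sub hl2).div_const 2).sub (hasDerivAt_id t)).const_mul
        ((1 - x ^ 2) / 2))).congr_deriv ?_
    have h3 : 1 - t ^ 2 = (1 - t) * (1 + t) := by ring
    simp only [id, h3]
    field_simp
    ring
  have := intervalIntegral.integral_le_sub_of_hasDeriv_right_of_le ha0
    (fun t ht => (hderiv t ht.1 (ht.2.trans_lt ha1)).continuousAt.continuousWithinAt)
    (fun t ht => (hderiv t ht.1.le (ht.2.trans ha1)).hasDerivWithinAt)
    ((integrableOn_ellE_integrand hx).mono_set (Set.Icc_subset_Icc_right ha1.le))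
    (fun t ht => ellE_integrand_le_tangent hx.le ht.1.le (ht.2.trans ha1))
  simpa using this

lemma integral_ellE_integrand_le_right {x p a : ℝ} (hx : x ^ 2 < 1) (hp : 0 < p)
    (hpx : p ^ 2 = 1 - x ^ 2) (ha0 : 0 ≤ a) (ha1 : a ≤ 1) :
    ∫ t in a..(1:ℝ), Real.sqrt ((1 - x ^ 2 * t ^ 2) / (1 - t ^ 2)) ≤
      1 - a + p ^ 2 * (Real.log (p + Real.sqrt (1 - a ^ 2)) - Real.log p) := by
  have := intervalIntegral.integral_le_sub_of_hasDeriv_right_of_le ha1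
    (g := fun t : ℝ => t + p ^ 2 * (-Real.log (p + Real.sqrt (1 - t ^ 2))))
    (continuousOn_id.add (continuousOn_const.mul (continuousOn_neg_log_add_sqrt hp _)))
    (fun t ht => ((hasDerivAt_id t).add ((hasDerivAt_neg_log_add_sqrt hp
      (by nlinarith [ht.1, ht.2])).const_mul (p ^ 2))).hasDerivWithinAt)
    ((integrableOn_ellE_integrand hx).mono_set (Set.Icc_subset_Icc_left ha0))
    (fun t ht => ellE_integrand_le_s10 hp hpx (ha0.trans ht.1.le) ht.2)
  refine this.trans (le_of_eq ?_)
  norm_num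
  ring

lemma three_mul_log_one_add_sub_log_le {s : ℝ} (hs : 2 / 3 ≤ s) :
    3 * Real.log (1 + s) - Real.log s - s ≤ 2 * Real.log 2 := by
  have hs0 : 0 < s := by linarith
  have hexp : (1 + s) ^ 3 ≤ 2 ^ 2 * s * Real.exp s := by
    have := Real.quadratic_le_exp_of_nonneg hs0.le
    nlinarith [mul_le_mul_of_nonneg_left this hs0.le, mul_pos hs0 hs0,
      mul_nonneg (sub_nonneg.2 hs) (sub_nonneg.2 hs), mul_pos hs0 (mul_pos hs0 hs0)]
  have hlog := Real.log_le_log (by positivity) hexp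
  rw [Real.log_mul (by positivity) (by positivity), Real.log_mul (by positivity) (by positivity),
    Real.log_exp, Real.log_pow, Real.log_pow] at hlog
  push_cast at hlog
  linarith

end EllipticBounds

theorem stmt10 (x : ℝ) (hx : 0 ≤ x) (hx1 : x < 1) :
    ellE x - 1 ≤ (1 - x^2) * ((1/4) * Real.log (1/(1-x^2)) + Real.log 2) := by
  have hx2 : x ^ 2 < 1 := by nlinarith
  have hq : 0 < 1 - x ^ 2 := by linarith
  obtain ⟨p, hp, hpx⟩ : ∃ p : ℝ, 0 < p ∧ p ^ 2 = 1 - x ^ 2 :=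
    ⟨Real.sqrt (1 - x ^ 2), Real.sqrt_pos.2 hq, Real.sq_sqrt hq.le⟩
  obtain ⟨s, hs0, hs⟩ : ∃ s : ℝ, 0 < s ∧ s ^ 2 * (1 + p ^ 2) = 1 := by
    refine ⟨Real.sqrt (1 / (1 + p ^ 2)), Real.sqrt_pos.2 (by positivity), ?_⟩
    rw [Real.sq_sqrt (by positivity)]
    field_simp
  have hps : 0 < p * s := mul_pos hp hs0
  have hs1 : s < 1 := by nlinarith
  have hs23 : 2 / 3 ≤ s := by nlinarith [sq_nonneg x, mul_nonneg (sq_nonneg s) (sq_nonneg x)]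
  have hsplit : ellE x = (∫ t in (0:ℝ)..s, Real.sqrt ((1 - x ^ 2 * t ^ 2) / (1 - t ^ 2))) +
      ∫ t in s..(1:ℝ), Real.sqrt ((1 - x ^ 2 * t ^ 2) / (1 - t ^ 2)) := by
    have hI := integrableOn_ellE_integrand hx2
    refine (intervalIntegral.integral_add_adjacent_intervals ?_ ?_).symm
    · exact (intervalIntegrable_iff_integrableOn_Icc_of_le hs0.le).2
        (hI.mono_set (Set.Icc_subset_Icc_right hs1.le))
    · exact (intervalIntegrable_iff_integrableOn_Icc_of_le hs1.le).2
        (hI.mono_set (Set.Icc_subset_Icc_left hs0.le))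
  have hleft := integral_ellE_integrand_le_left hx2 hs0.le hs1
  have hright := integral_ellE_integrand_le_right hx2 hp hpx hs0.le hs1.le
  have hsqrt : Real.sqrt (1 - s ^ 2) = p * s := by
    rw [show 1 - s ^ 2 = (p * s) ^ 2 by linarith, Real.sqrt_sq hps.le]
  have hlog1 : Real.log (p + p * s) = Real.log p + Real.log (1 + s) := by
    rw [← Real.log_mul hp.ne' (by positivity)]
    ring_nf
  have hlog2 : Real.log (1 + s) + Real.log (1 - s) = 2 * (Real.log p + Real.log s) := by
    rw [← Real.log_mul (by positivity) (by linarith), ← Real.log_mul hp.ne' hs0.ne',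
      show (1 + s) * (1 - s) = (p * s) ^ 2 by linarith, Real.log_pow]
    norm_num
  have hlogq : Real.log (1 / (1 - x ^ 2)) = -(2 * Real.log p) := by
    rw [← hpx, one_div, Real.log_inv, Real.log_pow]
    norm_num
  have hfin := mul_le_mul_of_nonneg_left (three_mul_log_one_add_sub_log_le hs23) hq.le
  rw [hsqrt, hlog1, hpx] at hright
  rw [show Real.log (1 - s) = 2 * (Real.log p + Real.log s) - Real.log (1 + s) by linarith]
    at hleft
  rw [hsplit, hlogq]
  linarith
end

section
/- The function Ψ : [0,1] → [0,1] defined by Ψ(k) = k/E(k) is a continuous, strictly increasing bijection of [0,1] onto [0,1], with Ψ(0) = 0 and Ψ(1) = 1. -/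
open MeasureTheory

theorem intervalIntegrable_sqrt_inv_one_sub_sq :
    IntervalIntegrable (fun t : ℝ => Real.sqrt (1 / (1 - t^2))) volume 0 1 := by
  have h : IntervalIntegrable (fun t : ℝ => 1 / Real.sqrt (1 - t^2)) volume 0 1 := by
    refine intervalIntegral.intervalIntegrable_deriv_of_nonneg (g := Real.arcsin)
      Real.continuous_arcsin.continuousOn ?_ ?_
    · intro x hx
      simp only [zero_le_one, min_eq_left, max_eq_right, Set.mem_Ioo] at hx
      exact Real.hasDerivAt_arcsin (by linarith) (by linarith)
    · intro x _
      positivity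
  simpa [Real.sqrt_inv] using h

theorem ellE_integrand_le_of_sq_le {a b t : ℝ} (hab : a^2 ≤ b^2) (ht : t ∈ Set.Icc (0:ℝ) 1) :
    Real.sqrt ((1 - b^2 * t^2) / (1 - t^2)) ≤ Real.sqrt ((1 - a^2 * t^2) / (1 - t^2)) := by
  have h : 0 ≤ 1 - t^2 := by nlinarith [ht.1, ht.2]
  gcongr

theorem aestronglyMeasurable_ellE_integrand (k : ℝ) (μ : Measure ℝ) :
    AEStronglyMeasurable (fun t : ℝ => Real.sqrt ((1 - k^2 * t^2) / (1 - t^2))) μ := by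
  have h : Measurable (fun t : ℝ => Real.sqrt ((1 - k^2 * t^2) / (1 - t^2))) := by fun_prop
  exact h.aestronglyMeasurable

theorem norm_ellE_integrand_le (k : ℝ) {t : ℝ} (ht : t ∈ Set.Icc (0:ℝ) 1) :
    ‖Real.sqrt ((1 - k^2 * t^2) / (1 - t^2))‖ ≤ Real.sqrt (1 / (1 - t^2)) := by
  rw [Real.norm_of_nonneg (Real.sqrt_nonneg _)]
  simpa using ellE_integrand_le_of_sq_le (a := 0) (b := k) (by simpa using sq_nonneg k) ht

theorem continuous_ellE : Continuous ellE := by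
  refine intervalIntegral.continuous_of_dominated_interval
    (fun k => aestronglyMeasurable_ellE_integrand k _) (fun k => ?_)
    intervalIntegrable_sqrt_inv_one_sub_sq ?_
  · refine Filter.Eventually.of_forall fun t ht => ?_
    rw [Set.uIoc_of_le zero_le_one] at ht
    exact norm_ellE_integrand_le k (Set.Ioc_subset_Icc_self ht)
  · refine Filter.Eventually.of_forall fun t _ => ?_
    fun_prop

theorem ellE_antitoneOn : AntitoneOn ellE (Set.Ici 0) := by
  intro a ha b _ hab
  exact intervalIntegral.integral_mono_on zero_le_one (intervalIntegrable_ellE_integrand b)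
    (intervalIntegrable_ellE_integrand a)
    fun t ht => ellE_integrand_le_of_sq_le (pow_le_pow_left₀ ha hab 2) ht

theorem ellE_one : ellE 1 = 1 := by
  have h : ellE 1 = ∫ _ in (0:ℝ)..1, (1:ℝ) := by
    refine intervalIntegral.integral_congr_Ioo_of_le zero_le_one fun t ht => ?_
    have : 1 - t^2 ≠ 0 := by nlinarith [ht.1, ht.2]
    simp [this]
  simpa using h

theorem one_le_ellE {k : ℝ} (hk : k ∈ Set.Icc (0:ℝ) 1) : 1 ≤ ellE k :=
  ellE_one ▸ ellE_antitoneOn hk.1 (zero_le_one' ℝ) hk.2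

theorem PsiFn_zero : PsiFn 0 = 0 := by simp [PsiFn]

theorem PsiFn_one : PsiFn 1 = 1 := by simp [PsiFn, ellE_one]

theorem continuousOn_PsiFn : ContinuousOn PsiFn (Set.Icc 0 1) :=
  continuousOn_id.div continuous_ellE.continuousOn
    fun _ hk => (zero_lt_one.trans_le (one_le_ellE hk)).ne'

theorem strictMonoOn_PsiFn : StrictMonoOn PsiFn (Set.Icc 0 1) := by
  intro a ha b hb hab
  have hpos : 0 < ellE b := zero_lt_one.trans_le (one_le_ellE hb)
  calc a / ellE a ≤ a / ellE b :=
        div_le_div_of_nonneg_left ha.1 hpos (ellE_antitoneOn ha.1 hb.1 hab.le)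
    _ < b / ellE b := div_lt_div_of_pos_right hab hpos

theorem bijOn_PsiFn : Set.BijOn PsiFn (Set.Icc 0 1) (Set.Icc 0 1) := by
  refine ⟨fun k hk => ?_, strictMonoOn_PsiFn.injOn, ?_⟩
  · have h := strictMonoOn_PsiFn.monotoneOn.mapsTo_Icc hk
    rwa [PsiFn_zero, PsiFn_one] at h
  · have h := intermediate_value_Icc zero_le_one continuousOn_PsiFn
    rwa [PsiFn_zero, PsiFn_one] at h

theorem stmt12 :
    ContinuousOn PsiFn (Set.Icc 0 1) ∧ StrictMonoOn PsiFn (Set.Icc 0 1) ∧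
    Set.BijOn PsiFn (Set.Icc 0 1) (Set.Icc 0 1) ∧ PsiFn 0 = 0 ∧ PsiFn 1 = 1 := by
  exact ⟨continuousOn_PsiFn, strictMonoOn_PsiFn, bijOn_PsiFn, PsiFn_zero, PsiFn_one⟩
end
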